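/- arXiv:2012.08030 — 2 statements merged into one kernel-verified Lean document; each statement's English description precedes it below -/
import Mathlib

section
/- Fix an integer n ≥ 3. The adjacent-swap Markov chain P on the unlabeled constrained ordered matchings COM_n satisfies the detailed balance equations with respect to the Tajima distribution: π(x)·P(x,y) = π(y)·P(y,x) for all x, y ∈ COM_n, where π(T) = 2^{n−c(T)−1}/(n−1)!. In particular π is the stationary distribution of the chain. -/
open Finset

/-- `p` is an unlabeled constrained ordered matching: each `p k` is a multiset of size two
over the symbols `Fin (n-1)` (symbol `0` stands for a leaf, symbol `j ≠ 0` for the internal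
label `j`); across all pairs the symbol `0` appears `n` times and each internal label once;
and the internal label `j` may only appear in pair `p k` (1-indexed pair `k+1`) when 
`j < k + 1`, i.e. `j ≤ k`. -/
def IsUCOMraw (n : ℕ) (p : Fin (n - 1) → Multiset (Fin (n - 1))) : Prop :=
  (∀ k, Multiset.card (p k) = 2) ∧
  (∀ s : Fin (n - 1), (∑ k, (p k).count s) = if (s : ℕ) = 0 then n else 1) ∧
  (∀ (j k : Fin (n - 1)), (j : ℕ) ≠ 0 → j ∈ p k → (j : ℕ) ≤ (k : ℕ))

instance (n : ℕ) : DecidablePred (IsUCOMraw n) := fun _ => by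
  unfold IsUCOMraw; infer_instance

instance (n : ℕ) :
    DecidablePred (fun p : Fin (n - 1) → Sym (Fin (n - 1)) 2 =>
      IsUCOMraw n (fun k => (p k : Multiset (Fin (n - 1))))) := fun _ => by
  infer_instance

/-- The set of unlabeled constrained ordered matchings `COM_n`; each pair is stored as an
unordered pair with possible repetition (`Sym _ 2`), with the validity predicate imposed on
the underlying multisets. -/
abbrev UCOM (n : ℕ) : Type :=
  {p : Fin (n - 1) → Sym (Fin (n - 1)) 2 //
    IsUCOMraw n (fun k => (p k : Multiset (Fin (n - 1))))}

/-- The sequence of size-two multisets underlying an unlabeled constrained ordered matching. -/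
def uraw (n : ℕ) (x : UCOM n) : Fin (n - 1) → Multiset (Fin (n - 1)) :=
  fun k => (x.val k : Multiset (Fin (n - 1)))

/-- Index of the pair `p_k` (1-indexed `k ∈ {1,…,n-2}`) as an element of `Fin (n-1)`. -/
def idx1 {n : ℕ} (k : Fin (n - 2)) : Fin (n - 1) := ⟨k, by have := k.isLt; omega⟩

/-- Index of the pair `p_{k+1}` as an element of `Fin (n-1)`. -/
def idx2 {n : ℕ} (k : Fin (n - 2)) : Fin (n - 1) := ⟨(k : ℕ) + 1, by have := k.isLt; omega⟩

/-- Result of exchanging symbol `l1` from pair `k` with symbol `l2` from pair `k+1`. -/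
def uswapFun (n : ℕ) (p : Fin (n - 1) → Multiset (Fin (n - 1))) (k : Fin (n - 2))
    (l1 l2 : Fin (n - 1)) : Fin (n - 1) → Multiset (Fin (n - 1)) :=
  fun i =>
    if i = idx1 k then l2 ::ₘ (p (idx1 k)).erase l1
    else if i = idx2 k then l1 ::ₘ (p (idx2 k)).erase l2
    else p i

/-- The state obtained from `x` when attempting to exchange `l1 ∈ p_k` with `l2 ∈ p_{k+1}`:
the swap is performed if it yields a valid constrained ordered matching,
otherwise the chain stays at `x`. -/
def uswapDest (n : ℕ) (x : UCOM n) (k : Fin (n - 2)) (l1 l2 : Fin (n - 1)) :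
    Fin (n - 1) → Multiset (Fin (n - 1)) :=
  if IsUCOMraw n (uswapFun n (uraw n x) k l1 l2) then uswapFun n (uraw n x) k l1 l2
  else uraw n x

/-- Transition matrix of the adjacent-swap Markov chain on `COM_n`:
pick `k ∈ {1,…,n-2}` uniformly, pick `l1` uniformly from the multiset `p_k`
and `l2` uniformly from the multiset `p_{k+1}` (each of the two slots of a pair
with probability 1/2), and swap them if allowed. -/
noncomputable def PU (n : ℕ) (x y : UCOM n) : ℝ :=
  (1 / ((n : ℝ) - 2)) * ∑ k : Fin (n - 2),
    ((uraw n x (idx1 k)).map (fun l1 =>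
      ((uraw n x (idx2 k)).map (fun l2 =>
        (1 / 4 : ℝ) * (if uswapDest n x k l1 l2 = uraw n y then 1 else 0))).sum)).sum

/-- The adjacent-swap transition matrix on `COM_n` as a matrix. -/
noncomputable def PUmat (n : ℕ) : Matrix (UCOM n) (UCOM n) ℝ := Matrix.of (PU n)

/-- The number of cherries of `T`: pairs all of whose elements are the leaf symbol `0`,
i.e. pairs equal to `{0,0}`. -/
def cherries (n : ℕ) (T : UCOM n) : ℕ :=
  (Finset.univ.filter (fun k : Fin (n - 1) => ∀ a ∈ uraw n T k, (a : ℕ) = 0)).card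

/-- The Tajima coalescent distribution on `COM_n`. -/
noncomputable def tajima (n : ℕ) (T : UCOM n) : ℝ :=
  (2 : ℝ) ^ (n - cherries n T - 1) / (Nat.factorial (n - 1))

/-- The (1-indexed, shifted down by one) index of the pair containing the internal label `j`:
`Ix n x j` is the unique `k` (0-indexed) with `j ∈ p_{k+1}`, so that `I_x(j) = Ix n x j + 1`. -/
noncomputable def Ix (n : ℕ) (x : UCOM n) (j : Fin (n - 1)) : ℕ :=
  sInf {k : ℕ | ∃ h : k < n - 1, j ∈ uraw n x ⟨k, h⟩}

/-- The internal tree length `φ(x) = ∑_{j=1}^{n-2} (I_x(j) - j)`. -/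
noncomputable def itl (n : ℕ) (x : UCOM n) : ℤ :=
  ∑ j ∈ Finset.univ.filter (fun j : Fin (n - 1) => (j : ℕ) ≠ 0),
    ((Ix n x j : ℤ) + 1 - (j : ℤ))

/-- Number of orderings of a pair. -/
noncomputable def wt {m : ℕ} (A : Multiset (Fin m)) : ℝ :=
  if ∀ a ∈ A, (a : ℕ) = 0 then 1 else 2

lemma wt_mul_sum {m : ℕ} (A : Multiset (Fin m)) (hc : Multiset.card A = 2)
    (h1 : ∀ s : Fin m, (s : ℕ) ≠ 0 → A.count s ≤ 1) (f : Fin m → ℝ) :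
    wt A * (A.map f).sum = 2 * ∑ l, if l ∈ A then f l else 0 := by
  obtain ⟨a, b, rfl⟩ := Multiset.card_eq_two.1 hc
  by_cases hab : a = b
  · subst hab
    have h0 : (a : ℕ) = 0 := by
      by_contra h
      have := h1 a h
      simp at this
    have e : ∀ l : Fin m, (if l ∈ ({a, a} : Multiset (Fin m)) then f l else 0)
        = if l = a then f l else 0 := by
      intro l; simp
    rw [Finset.sum_congr rfl (fun l _ => e l)]
    simp [wt, h0]
    ring
  · have hw : wt ({a, b} : Multiset (Fin m)) = 2 := by
      unfold wt
      rw [if_neg]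
      intro h
      apply hab
      apply Fin.ext
      rw [h a (by simp), h b (by simp)]
    have e : ∀ l : Fin m, (if l ∈ ({a, b} : Multiset (Fin m)) then f l else 0)
        = (if l = a then f l else 0) + if l = b then f l else 0 := by
      intro l
      by_cases h : l = a
      · subst h; simp [hab]
      · simp [h]
    rw [Finset.sum_congr rfl (fun l _ => e l), Finset.sum_add_distrib, hw]
    simp

lemma tajima_eq (n : ℕ) (x : UCOM n) :
    tajima n x = (∏ k, wt (uraw n x k)) / (Nat.factorial (n - 1)) := by
  unfold tajima
  congr 1
  unfold wt
  rw [Finset.prod_ite]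
  simp only [Finset.prod_const, one_pow, one_mul]
  congr 1
  have := Finset.card_filter_add_card_filter_not (s := (Finset.univ : Finset (Fin (n-1))))
    (fun k : Fin (n - 1) => ∀ a ∈ uraw n x k, (a : ℕ) = 0)
  simp only [Finset.card_univ, Fintype.card_fin] at this
  unfold cherries
  omega

lemma idx_ne {n : ℕ} (k : Fin (n - 2)) : idx2 k ≠ idx1 k := by
  intro h
  have := congrArg Fin.val h
  simp [idx1, idx2] at this

lemma swap_rev {n : ℕ} {p q : Fin (n - 1) → Multiset (Fin (n - 1))} {k : Fin (n - 2)}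
    {l1 l2 : Fin (n - 1)} (h1 : l1 ∈ p (idx1 k)) (h2 : l2 ∈ p (idx2 k))
    (h : uswapFun n p k l1 l2 = q) :
    l2 ∈ q (idx1 k) ∧ l1 ∈ q (idx2 k) ∧ uswapFun n q k l2 l1 = p := by
  have hne := idx_ne k
  subst h
  have e1 : uswapFun n p k l1 l2 (idx1 k) = l2 ::ₘ (p (idx1 k)).erase l1 := by
    simp [uswapFun]
  have e2 : uswapFun n p k l1 l2 (idx2 k) = l1 ::ₘ (p (idx2 k)).erase l2 := by
    simp [uswapFun, hne]
  refine ⟨by rw [e1]; simp, by rw [e2]; simp, ?_⟩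
  funext i
  by_cases hi : i = idx1 k
  · subst hi
    rw [uswapFun, if_pos rfl, e1, Multiset.erase_cons_head, Multiset.cons_erase h1]
  · by_cases hi2 : i = idx2 k
    · subst hi2
      rw [uswapFun, if_neg hi, if_pos rfl, e2, Multiset.erase_cons_head, Multiset.cons_erase h2]
    · simp [uswapFun, hi, hi2]

lemma swap_iff {n : ℕ} {p q : Fin (n - 1) → Multiset (Fin (n - 1))} {k : Fin (n - 2)}
    {l1 l2 : Fin (n - 1)} :
    (l1 ∈ p (idx1 k) ∧ l2 ∈ p (idx2 k) ∧ uswapFun n p k l1 l2 = q) ↔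
    (l2 ∈ q (idx1 k) ∧ l1 ∈ q (idx2 k) ∧ uswapFun n q k l2 l1 = p) :=
  ⟨fun h => swap_rev h.1 h.2.1 h.2.2, fun h => swap_rev h.1 h.2.1 h.2.2⟩

lemma count_le {n : ℕ} {p : Fin (n - 1) → Multiset (Fin (n - 1))} (hp : IsUCOMraw n p)
    (k : Fin (n - 1)) (s : Fin (n - 1)) (hs : (s : ℕ) ≠ 0) : (p k).count s ≤ 1 := by
  have h := hp.2.1 s
  rw [if_neg hs] at h
  refine le_trans ?_ h.le
  exact Finset.single_le_sum (f := fun k => (p k).count s) (fun _ _ => Nat.zero_le _)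
    (Finset.mem_univ k)

lemma weighted (n : ℕ) {p : Fin (n - 1) → Multiset (Fin (n - 1))} (hp : IsUCOMraw n p)
    (q : Fin (n - 1) → Multiset (Fin (n - 1))) (k : Fin (n - 2)) :
    (∏ i, wt (p i)) * ((p (idx1 k)).map (fun l1 => ((p (idx2 k)).map (fun l2 =>
        (1 / 4 : ℝ) * (if uswapFun n p k l1 l2 = q then 1 else 0))).sum)).sum
    = ∑ l1, ∑ l2, if (l1 ∈ p (idx1 k) ∧ l2 ∈ p (idx2 k) ∧ uswapFun n p k l1 l2 = q) then
        ∏ i ∈ (Finset.univ.erase (idx1 k)).erase (idx2 k), wt (p i) else 0 := by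
  rw [← Finset.mul_prod_erase _ _ (Finset.mem_univ (idx1 k)),
    ← Finset.mul_prod_erase (Finset.univ.erase (idx1 k)) _
      (Finset.mem_erase.2 ⟨idx_ne k, Finset.mem_univ (idx2 k)⟩)]
  generalize ∏ i ∈ (Finset.univ.erase (idx1 k)).erase (idx2 k), wt (p i) = C
  have a1 := wt_mul_sum (p (idx1 k)) (hp.1 _) (count_le hp _)
  have a2 := wt_mul_sum (p (idx2 k)) (hp.1 _) (count_le hp _)
  rw [show ∀ u v S : ℝ, u * (v * C) * S = (C * v) * (u * S) by intros; ring, a1,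
    ← mul_assoc, Finset.mul_sum]
  refine Finset.sum_congr rfl fun l1 _ => ?_
  by_cases h : l1 ∈ p (idx1 k)
  · rw [if_pos h, show ∀ v S : ℝ, C * v * 2 * S = (C * 2) * (v * S) by intros; ring, a2,
      ← mul_assoc, Finset.mul_sum]
    refine Finset.sum_congr rfl fun l2 _ => ?_
    by_cases h2 : l2 ∈ p (idx2 k) <;> by_cases h3 : uswapFun n p k l1 l2 = q <;>
      simp [h, h2, h3]
    ring
  · simp [h]

lemma uraw_inj {n : ℕ} {x y : UCOM n} (h : uraw n x = uraw n y) : x = y := by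
  apply Subtype.ext
  funext k
  apply Subtype.ext
  exact congrFun h k

lemma dest_iff {n : ℕ} {x y : UCOM n} (hxy : x ≠ y) (k : Fin (n - 2)) (l1 l2 : Fin (n - 1)) :
    uswapDest n x k l1 l2 = uraw n y ↔ uswapFun n (uraw n x) k l1 l2 = uraw n y := by
  unfold uswapDest
  split_ifs with h
  · rfl
  · constructor
    · intro h'; exact absurd (uraw_inj h') hxy
    · intro h'; rw [h'] at h; exact absurd y.2 h

lemma detailed (n : ℕ) (x y : UCOM n) :
    tajima n x * PU n x y = tajima n y * PU n y x := by
  by_cases hxy : x = y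
  · subst hxy; rfl
  rw [tajima_eq, tajima_eq]
  unfold PU
  simp only [dest_iff hxy, dest_iff (Ne.symm hxy)]
  have e : ∀ a b c d : ℝ, a / b * (c * d) = (c / b) * (a * d) := by intros; ring
  refine (e _ _ _ _).trans (Eq.trans ?_ (e _ _ _ _).symm)
  refine congrArg _ ?_
  rw [Finset.mul_sum, Finset.mul_sum]
  refine Finset.sum_congr rfl fun k _ => ?_
  rw [weighted n (p := uraw n x) x.2 (uraw n y) k,
    weighted n (p := uraw n y) y.2 (uraw n x) k]
  conv_rhs => rw [Finset.sum_comm]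
  refine Finset.sum_congr rfl fun l1 _ => Finset.sum_congr rfl fun l2 _ => ?_
  refine ite_congr (propext swap_iff) (fun h => ?_) (fun _ => rfl)
  refine Finset.prod_congr rfl fun i hi => ?_
  simp only [Finset.mem_erase] at hi
  have := congrFun h.2.2 i
  simp only [uswapFun, if_neg hi.1, if_neg hi.2.1] at this
  rw [this]

lemma dest_valid (n : ℕ) (x : UCOM n) (k : Fin (n - 2)) (l1 l2 : Fin (n - 1)) :
    IsUCOMraw n (uswapDest n x k l1 l2) := by
  unfold uswapDest
  split_ifs with h
  · exact h
  · exact x.2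

lemma dest_sum (n : ℕ) (x : UCOM n) (k : Fin (n - 2)) (l1 l2 : Fin (n - 1)) :
    ∑ y : UCOM n, (1 / 4 : ℝ) * (if uswapDest n x k l1 l2 = uraw n y then 1 else 0) = 1 / 4 := by
  have hv := dest_valid n x k l1 l2
  let z : UCOM n := ⟨fun i => ⟨uswapDest n x k l1 l2 i, hv.1 i⟩, hv⟩
  have hz : uswapDest n x k l1 l2 = uraw n z := rfl
  rw [Finset.sum_eq_single z]
  · rw [if_pos hz, mul_one]
  · intro y _ hy
    rw [if_neg, mul_zero]
    intro h
    exact hy (uraw_inj (h.symm.trans hz))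
  · intro h; exact absurd (Finset.mem_univ z) h

lemma row_sum (n : ℕ) (hn : 3 ≤ n) (x : UCOM n) : ∑ y : UCOM n, PU n x y = 1 := by
  unfold PU
  rw [← Finset.mul_sum, Finset.sum_comm]
  have key : ∀ k : Fin (n - 2), ∑ y : UCOM n, ((uraw n x (idx1 k)).map (fun l1 =>
      ((uraw n x (idx2 k)).map (fun l2 =>
        (1 / 4 : ℝ) * (if uswapDest n x k l1 l2 = uraw n y then 1 else 0))).sum)).sum = 1 := by
    intro k
    simp only [← Multiset.sum_map_sum, dest_sum]
    have c1 : Multiset.card (uraw n x (idx1 k)) = 2 := x.2.1 _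
    have c2 : Multiset.card (uraw n x (idx2 k)) = 2 := x.2.1 _
    simp only [Multiset.map_const', Multiset.sum_replicate, c1, c2]
    norm_num
  simp only [key]
  have : (n : ℝ) - 2 ≠ 0 := by
    have : (3 : ℝ) ≤ n := by exact_mod_cast hn
    linarith
  simp only [Finset.sum_const, Finset.card_univ, Fintype.card_fin, nsmul_eq_mul, mul_one]
  rw [Nat.cast_sub (by omega)]
  push_cast
  field_simp

/-- For `n ≥ 3`, the adjacent-swap chain on `COM_n` satisfies detailed balance
with respect to the Tajima distribution `π(T) = 2^{n−c(T)−1}/(n−1)!`; in particular the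
Tajima distribution is stationary. -/
theorem stmt5 (n : ℕ) (hn : 3 ≤ n) :
    (∀ x y : UCOM n, tajima n x * PU n x y = tajima n y * PU n y x) ∧
    (∀ y : UCOM n, ∑ x : UCOM n, tajima n x * PU n x y = tajima n y) := by
  refine ⟨detailed n, fun y => ?_⟩
  rw [Finset.sum_congr rfl (fun x _ => detailed n x y), ← Finset.mul_sum, row_sum n hn, mul_one]
end

section
/- Fix an integer n ≥ 3. Under the Tajima distribution π on COM_n, the expected internal tree length is E_π[φ] = ∑_{T ∈ COM_n} π(T) φ(T) = (n² + n − 6)/6. -/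
open Finset

noncomputable def fibC {m M : ℕ} (f : Fin m → Fin M) (k : Fin M) : ℕ :=
  ∑ i, if f i = k then 1 else 0

noncomputable def wgt {m M : ℕ} (f : Fin m → Fin M) : ℝ :=
  if ∀ i, (f i : ℕ) ≤ i then ∏ k, ((Nat.descFactorial 2 (fibC f k) : ℕ) : ℝ) else 0

lemma desc_two (c : ℕ) :
    ((Nat.descFactorial 2 (c + 1) : ℕ) : ℝ) = (Nat.descFactorial 2 c : ℕ) * (2 - (c : ℝ)) := by
  rcases Nat.lt_or_ge 2 c with h | h
  · rw [Nat.descFactorial_of_lt h, Nat.descFactorial_of_lt (by omega)]; simp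
  · rw [Nat.descFactorial_succ]; push_cast [h]; ring

lemma fibC_snoc {m M : ℕ} (f : Fin m → Fin M) (k l : Fin M) :
    fibC (Fin.snoc f k : Fin (m + 1) → Fin M) l = fibC f l + if k = l then 1 else 0 := by
  simp only [fibC, Fin.sum_univ_castSucc, Fin.snoc_castSucc, Fin.snoc_last]

lemma wgt_snoc {m M : ℕ} (f : Fin m → Fin M) (k : Fin M) :
    wgt (Fin.snoc f k : Fin (m + 1) → Fin M) =
      wgt f * (if (k : ℕ) ≤ m then 2 - (fibC f k : ℝ) else 0) := by
  have h1 : (∀ i, ((Fin.snoc f k : Fin (m + 1) → Fin M) i : ℕ) ≤ i) ↔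
      (∀ i, (f i : ℕ) ≤ i) ∧ (k : ℕ) ≤ m := by
    rw [Fin.forall_fin_succ']; simp
  have h2 : ∏ l, ((Nat.descFactorial 2 (fibC (Fin.snoc f k : Fin (m + 1) → Fin M) l) : ℕ) : ℝ)
      = (∏ l, ((Nat.descFactorial 2 (fibC f l) : ℕ) : ℝ)) * (2 - (fibC f k : ℝ)) := by
    have : (2 - (fibC f k : ℝ)) = ∏ l, (if k = l then (2 - (fibC f l : ℝ)) else 1) := by
      simp
    rw [this, ← Finset.prod_mul_distrib]
    refine Finset.prod_congr rfl fun l _ => ?_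
    rw [fibC_snoc]
    split_ifs with h
    · rw [desc_two]
    · simp
  unfold wgt
  rw [h2]
  by_cases ha : ∀ i, (f i : ℕ) ≤ i
  · by_cases hb : (k : ℕ) ≤ m
    · rw [if_pos (h1.2 ⟨ha, hb⟩), if_pos ha, if_pos hb]
    · rw [if_neg (fun h => hb (h1.1 h).2), if_neg hb, mul_zero]
  · rw [if_neg (fun h => ha (h1.1 h).1), if_neg ha, zero_mul]

lemma step_sum {m M : ℕ} (f : Fin m → Fin M) (h : ℕ → ℝ) (hm : m < M) :
    wgt f * ∑ k : Fin M, (if (k : ℕ) ≤ m then 2 - (fibC f k : ℝ) else 0) * h k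
      = wgt f * (2 * ∑ k ∈ range (m + 1), h k - ∑ i, h (f i)) := by
  by_cases ha : ∀ i, (f i : ℕ) ≤ i
  swap
  · simp [wgt, ha]
  congr 1
  have h1 : ∑ k : Fin M, (if (k : ℕ) ≤ m then h k else 0) = ∑ k ∈ range (m + 1), h k := by
    rw [Fin.sum_univ_eq_sum_range (fun k => if k ≤ m then h k else 0) M, ← Finset.sum_filter]
    congr 1
    ext x; simp; omega
  have h2 : ∑ k : Fin M, (if (k : ℕ) ≤ m then (fibC f k : ℝ) * h k else 0) = ∑ i, h (f i) := by
    have : ∀ k : Fin M, (if (k : ℕ) ≤ m then (fibC f k : ℝ) * h k else 0)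
        = ∑ i, if f i = k then h k else 0 := by
      intro k
      simp only [fibC]
      push_cast
      rw [Finset.sum_mul]
      split_ifs with hk
      · simp
      · symm
        refine Finset.sum_eq_zero fun i _ => if_neg ?_
        rintro rfl
        have := ha i
        have := i.2
        omega
    simp_rw [this]
    rw [Finset.sum_comm]
    simp
  rw [← h1, ← h2, Finset.mul_sum, ← Finset.sum_sub_distrib]
  refine Finset.sum_congr rfl fun k _ => ?_
  split_ifs <;> ring

lemma sum_snoc {m M : ℕ} (F : (Fin (m + 1) → Fin M) → ℝ) :
    ∑ g, F g = ∑ f : Fin m → Fin M, ∑ k, F (Fin.snoc f k : Fin (m + 1) → Fin M) := by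
  rw [← Equiv.sum_comp (Fin.snocEquiv (fun _ : Fin (m + 1) => Fin M)) F, Fintype.sum_prod_type,
    Finset.sum_comm]
  rfl

lemma A_eq (M m : ℕ) (hm : m < M + 1) :
    ∑ f : Fin m → Fin M, wgt f = ((m + 1).factorial : ℝ) := by
  induction m with
  | zero => simp [wgt, fibC]
  | succ m ih =>
    rw [sum_snoc]
    have : ∀ f : Fin m → Fin M, ∑ k, wgt (Fin.snoc f k : Fin (m + 1) → Fin M)
        = wgt f * (m + 2) := by
      intro f
      have := step_sum f (fun _ => 1) (by omega)
      simp only [wgt_snoc, ← Finset.mul_sum]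
      simp only [mul_one] at this
      rw [this]
      congr 1
      simp; ring
    simp_rw [this]
    rw [← Finset.sum_mul, ih (by omega), Nat.factorial_succ (m + 1)]
    push_cast; ring

lemma B_eq (M m : ℕ) (hm : m < M + 1) :
    ∑ f : Fin m → Fin M, wgt f * ∑ i, ((f i : ℕ) : ℝ)
      = ((m + 1).factorial : ℝ) * (m * (m - 1) / 3) := by
  induction m with
  | zero => simp
  | succ m ih =>
    rw [sum_snoc]
    have : ∀ f : Fin m → Fin M, ∑ k, wgt (Fin.snoc f k : Fin (m + 1) → Fin M) *
          ∑ i, (((Fin.snoc f k : Fin (m + 1) → Fin M) i : ℕ) : ℝ)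
        = (m + 1) * (wgt f * ∑ i, ((f i : ℕ) : ℝ)) + wgt f * (m * (m + 1)) := by
      intro f
      have e1 := step_sum f (fun _ => 1) (by omega)
      have e2 := step_sum f (fun k => (k : ℝ)) (by omega)
      have g : ∑ k ∈ range (m + 1), (k : ℝ) = m * (m + 1) / 2 := by
        clear * -
        induction m with
        | zero => simp
        | succ m ih => rw [Finset.sum_range_succ, ih]; push_cast; ring
      rw [g] at e2
      have e3 : ∑ k, wgt (Fin.snoc f k : Fin (m + 1) → Fin M) *
          ∑ i, (((Fin.snoc f k : Fin (m + 1) → Fin M) i : ℕ) : ℝ)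
          = (wgt f * ∑ k : Fin M, (if (k : ℕ) ≤ m then 2 - (fibC f k : ℝ) else 0) * 1)
              * ∑ i, ((f i : ℕ) : ℝ)
            + wgt f * ∑ k : Fin M, (if (k : ℕ) ≤ m then 2 - (fibC f k : ℝ) else 0) * (k : ℕ) := by
        generalize hS : ∑ i, ((f i : ℕ) : ℝ) = S
        rw [Finset.mul_sum, Finset.mul_sum, Finset.sum_mul, ← Finset.sum_add_distrib]
        refine Finset.sum_congr rfl fun k _ => ?_
        rw [wgt_snoc, Fin.sum_univ_castSucc]
        simp only [Fin.snoc_castSucc, Fin.snoc_last]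
        rw [hS]
        ring
      rw [e3, e1, e2]
      simp
      ring
    simp_rw [this]
    rw [Finset.sum_add_distrib, ← Finset.mul_sum, ← Finset.sum_mul, ih (by omega),
      A_eq M m (by omega), Nat.factorial_succ (m + 1)]
    push_cast; ring

lemma final_sum (m : ℕ) :
    ∑ f : Fin m → Fin (m + 1), wgt f * ∑ i : Fin m, (1 + ((i : ℕ) : ℝ) - ((f i : ℕ) : ℝ))
      = ((m + 1).factorial : ℝ) * (m + m * (m - 1) / 6) := by
  have g : ∑ i : Fin m, (1 + ((i : ℕ) : ℝ)) = m + m * (m - 1) / 2 := by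
    rw [Fin.sum_univ_eq_sum_range (fun i => 1 + (i : ℝ)) m]
    induction m with
    | zero => simp
    | succ m ih => rw [Finset.sum_range_succ, ih]; push_cast; ring
  simp_rw [Finset.sum_sub_distrib, mul_sub, g]
  rw [Finset.sum_sub_distrib, ← Finset.sum_mul, A_eq _ _ (by omega), B_eq _ _ (by omega)]
  ring

def lab {m : ℕ} (i : Fin m) : Fin (m + 1) := Fin.rev (Fin.castSucc i)

lemma lab_val {m : ℕ} (i : Fin m) : ((lab i : Fin (m + 1)) : ℕ) = m - i := by
  simp [lab, Fin.val_rev]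

lemma lab_ne {m : ℕ} (i : Fin m) : (lab i : Fin (m + 1)) ≠ 0 := by
  intro h
  have := congrArg Fin.val h
  rw [lab_val] at this
  have := i.2
  simp at *
  omega

lemma lab_inj {m : ℕ} : Function.Injective (lab : Fin m → Fin (m + 1)) := by
  intro a b h
  simpa [lab] using h

lemma lab_cases {m : ℕ} (s : Fin (m + 1)) : s = 0 ∨ ∃ i : Fin m, s = lab i := by
  rw [← Fin.rev_rev s]
  induction Fin.rev s using Fin.lastCases with
  | last => left; simp
  | cast i => right; exact ⟨i, rfl⟩

lemma sum_lab {m : ℕ} {R : Type*} [AddCommMonoid R] (F : Fin (m + 1) → R) :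
    ∑ s, F s = ∑ i, F (lab i) + F 0 := by
  rw [← Equiv.sum_comp Fin.revPerm F, Fin.sum_univ_castSucc]
  simp [lab]

noncomputable def pairOf {m : ℕ} (f : Fin m → Fin (m + 1)) (k : Fin (m + 1)) :
    Multiset (Fin (m + 1)) :=
  (univ.filter (fun i => f i = k.rev)).val.map lab + Multiset.replicate (2 - fibC f k.rev) 0

lemma fibC_card {m M : ℕ} (f : Fin m → Fin M) (k : Fin M) :
    fibC f k = (univ.filter (fun i => f i = k)).card := by
  simp [fibC]

lemma count_lab_pairOf {m : ℕ} (f : Fin m → Fin (m + 1)) (k : Fin (m + 1)) (i : Fin m) :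
    (pairOf f k).count (lab i) = if f i = k.rev then 1 else 0 := by
  rw [pairOf, Multiset.count_add, Multiset.count_map_eq_count' _ _ lab_inj,
    Multiset.count_replicate, if_neg (lab_ne i).symm, add_zero,
    Multiset.count_eq_of_nodup (Finset.nodup _)]
  simp

lemma count_zero_pairOf {m : ℕ} (f : Fin m → Fin (m + 1)) (k : Fin (m + 1)) :
    (pairOf f k).count 0 = 2 - fibC f k.rev := by
  rw [pairOf, Multiset.count_add, Multiset.count_replicate_self, Multiset.count_eq_zero.2, zero_add]
  simp only [Multiset.mem_map, not_exists, not_and]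
  exact fun i _ => lab_ne i

/-- Structure of a matching. -/
lemma exists_fun {m : ℕ} (T : UCOM (m + 2)) :
    ∃ f : Fin m → Fin (m + 1), (∀ i, (f i : ℕ) ≤ i) ∧ (∀ k, fibC f k ≤ 2) ∧
      ∀ k : Fin (m + 1), uraw (m + 2) T k = pairOf f k := by
  obtain ⟨hc, hs, ho⟩ := T.2
  change ∀ k : Fin (m + 1), Multiset.card (uraw (m + 2) T k) = 2 at hc
  change ∀ s : Fin (m + 1), (∑ k : Fin (m + 1), (uraw (m + 2) T k).count s)
    = if (s : ℕ) = 0 then m + 2 else 1 at hs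
  change ∀ j k : Fin (m + 1), (j : ℕ) ≠ 0 → j ∈ uraw (m + 2) T k → (j : ℕ) ≤ k at ho
  have h1 : ∀ i : Fin m, ∃ d : Fin (m + 1), ∀ k : Fin (m + 1),
      (uraw (m + 2) T k).count (lab i) = if d = k.rev then 1 else 0 := by
    intro i
    have h := hs (lab i)
    rw [if_neg (by have := lab_ne i; intro h; apply this; ext; simpa using h)] at h
    have hne : ∃ k : Fin (m + 1), (uraw (m + 2) T k).count (lab i) ≠ 0 := by
      by_contra! hcon
      simp [hcon] at h
    obtain ⟨k0, hk0⟩ := hne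
    refine ⟨k0.rev, fun k => ?_⟩
    rw [← Finset.add_sum_erase _ _ (Finset.mem_univ k0)] at h
    have h0 : ∑ k ∈ univ.erase k0, (uraw (m + 2) T k).count (lab i) = 0 := by omega
    by_cases hk : k0 = k
    · subst hk; rw [if_pos rfl]; omega
    · rw [if_neg (by simpa using hk)]
      exact (Finset.sum_eq_zero_iff.1 h0) k (by simp [Ne.symm hk])
  choose f hf using h1
  have h2 : ∀ k : Fin (m + 1), fibC f k.rev + (uraw (m + 2) T k).count (0 : Fin (m + 1)) = 2 := by
    intro k
    have h := hc k
    have h' : ∑ s : Fin (m + 1), (uraw (m + 2) T k).count s = Multiset.card (uraw (m + 2) T k) :=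
      Multiset.sum_count_eq_card (fun _ _ => Finset.mem_univ _)
    rw [sum_lab, h] at h'
    simp_rw [hf] at h'
    exact h'
  refine ⟨f, fun i => ?_, fun k => ?_, fun k => ?_⟩
  · have hmem : lab i ∈ uraw (m + 2) T (f i).rev := by
      rw [← Multiset.count_pos, hf]; simp
    have := ho (lab i) (f i).rev (by rw [lab_val]; have := i.2; omega) hmem
    rw [lab_val, Fin.val_rev] at this
    have := (f i).2
    have := i.2
    omega
  · have := h2 k.rev
    rw [Fin.rev_rev] at this
    omega
  · refine Multiset.ext.2 fun s => ?_
    rcases lab_cases s with rfl | ⟨i, rfl⟩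
    · rw [count_zero_pairOf]
      have := h2 k
      omega
    · rw [hf, count_lab_pairOf]

lemma pairOf_valid {m : ℕ} (f : Fin m → Fin (m + 1)) (hf : ∀ i, (f i : ℕ) ≤ i)
    (h2 : ∀ k, fibC f k ≤ 2) : IsUCOMraw (m + 2) (pairOf f) := by
  have hcard : ∀ k, Multiset.card (pairOf f k) = 2 := by
    intro k
    have := h2 k.rev
    simp only [pairOf, Multiset.card_add, Multiset.card_map, Multiset.card_replicate,
      Finset.card_val, ← fibC_card]
    omega
  have hl : ∀ i : Fin m, ∑ k : Fin (m + 1), (pairOf f k).count (lab i) = 1 := by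
    intro i
    simp_rw [count_lab_pairOf]
    rw [← Equiv.sum_comp Fin.revPerm]
    simp
  refine ⟨hcard, ?_, ?_⟩
  · change ∀ s : Fin (m + 1), (∑ k : Fin (m + 1), (pairOf f k).count s)
      = if (s : ℕ) = 0 then m + 2 else 1
    intro s
    rcases lab_cases s with rfl | ⟨i, rfl⟩
    · have h : ∑ s : Fin (m + 1), ∑ k : Fin (m + 1), (pairOf f k).count s = 2 * (m + 1) := by
        rw [Finset.sum_comm]
        have : ∀ k : Fin (m + 1), ∑ s : Fin (m + 1), (pairOf f k).count s = 2 := fun k => by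
          rw [← hcard k]
          exact Multiset.sum_count_eq_card (fun _ _ => Finset.mem_univ _)
        simp_rw [this]
        simp; ring
      rw [sum_lab] at h
      simp_rw [hl] at h
      simp at h ⊢
      omega
    · rw [hl, if_neg]
      rw [lab_val]; have := i.2; omega
  · change ∀ j k : Fin (m + 1), (j : ℕ) ≠ 0 → j ∈ pairOf f k → (j : ℕ) ≤ k
    intro j k hj hjk
    rcases lab_cases j with rfl | ⟨i, rfl⟩
    · simp at hj
    · rw [← Multiset.count_pos, count_lab_pairOf] at hjk
      have h : f i = k.rev := by by_contra h; simp [h] at hjk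
      have := hf i
      rw [h, Fin.val_rev] at this
      rw [lab_val]
      have := i.2
      omega

lemma weight_eq {m : ℕ} (T : UCOM (m + 2)) (f : Fin m → Fin (m + 1)) (hf : ∀ i, (f i : ℕ) ≤ i)
    (h2 : ∀ k, fibC f k ≤ 2) (hT : ∀ k : Fin (m + 1), uraw (m + 2) T k = pairOf f k) :
    tajima (m + 2) T = wgt f / ((m + 1).factorial : ℝ) := by
  have hch : cherries (m + 2) T = (univ.filter (fun k : Fin (m + 1) => fibC f k.rev = 0)).card := by
    unfold cherries
    change (univ.filter (fun k : Fin (m + 1) => ∀ a ∈ uraw (m + 2) T k, (a : ℕ) = 0)).card = _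
    congr 1
    ext k
    simp only [Finset.mem_filter, Finset.mem_univ, true_and]
    rw [hT]
    constructor
    · intro h
      unfold fibC
      refine Finset.sum_eq_zero fun i _ => if_neg fun hi => ?_
      have := h (lab i) (by rw [← Multiset.count_pos, count_lab_pairOf, if_pos hi]; omega)
      rw [lab_val] at this
      have := i.2
      omega
    · intro h a ha
      rcases lab_cases a with rfl | ⟨i, rfl⟩
      · simp
      · exfalso
        rw [← Multiset.count_pos, count_lab_pairOf] at ha
        have hi : f i = k.rev := by by_contra h; simp [h] at ha
        rw [fibC_card, Finset.card_eq_zero] at h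
        have : i ∈ univ.filter (fun i => f i = k.rev) := by simp [hi]
        rw [h] at this
        simp at this
  unfold tajima wgt
  rw [if_pos hf]
  change _ / ((m + 1).factorial : ℝ) = _
  congr 1
  have e1 : ∀ k, ((Nat.descFactorial 2 (fibC f k) : ℕ) : ℝ) = if fibC f k = 0 then 1 else 2 := by
    intro k
    have := h2 k
    interval_cases fibC f k <;> simp [Nat.descFactorial]
  have e2 : m + 2 - cherries (m + 2) T - 1
      = (univ.filter (fun k : Fin (m + 1) => ¬ fibC f k.rev = 0)).card := by
    have := Finset.card_filter_add_card_filter_not (s := (univ : Finset (Fin (m + 1))))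
      (fun k : Fin (m + 1) => fibC f k.rev = 0)
    rw [← hch] at this
    simp at this ⊢
    omega
  rw [e2, ← Equiv.prod_comp Fin.revPerm]
  simp_rw [e1]
  rw [Finset.prod_ite]
  simp

lemma itl_eq {m : ℕ} (T : UCOM (m + 2)) (f : Fin m → Fin (m + 1))
    (hT : ∀ k : Fin (m + 1), uraw (m + 2) T k = pairOf f k) :
    ((itl (m + 2) T : ℤ) : ℝ) = ∑ i : Fin m, (1 + ((i : ℕ) : ℝ) - ((f i : ℕ) : ℝ)) := by
  have hI : ∀ i : Fin m, Ix (m + 2) T (lab i) = m - f i := by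
    intro i
    unfold Ix
    have : {k : ℕ | ∃ h : k < m + 2 - 1, lab i ∈ uraw (m + 2) T ⟨k, h⟩} = {m - (f i : ℕ)} := by
      ext k
      simp only [Set.mem_ofPred_eq, Set.mem_singleton_iff]
      have hfi := (f i).2
      have key : ∀ h : k < m + 1, lab i ∈ uraw (m + 2) T (⟨k, h⟩ : Fin (m + 1)) ↔
          k = m - (f i : ℕ) := by
        intro h
        rw [hT, ← Multiset.count_pos, count_lab_pairOf]
        have : f i = (⟨k, h⟩ : Fin (m + 1)).rev ↔ k = m - (f i : ℕ) := by
          rw [Fin.ext_iff, Fin.val_rev]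
          simp only
          omega
        rw [← this]
        split_ifs with h <;> simp [h]
      constructor
      · rintro ⟨h, h'⟩
        exact (key h).1 h'
      · intro h
        exact ⟨by omega, (key (by omega)).2 h⟩
    rw [this, csInf_singleton]
  have e : itl (m + 2) T = ∑ i : Fin m, ((Ix (m + 2) T (lab i) : ℤ) + 1 - ((lab i : Fin (m + 1)) : ℕ)) := by
    unfold itl
    rw [Finset.sum_filter]
    change ∑ j : Fin (m + 1), _ = _
    rw [sum_lab]
    rw [if_neg (by simp), add_zero]
    refine Finset.sum_congr rfl fun i _ => if_pos ?_
    rw [lab_val]; have := i.2; omega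
  rw [e]
  push_cast
  refine Finset.sum_congr rfl fun i _ => ?_
  rw [hI, lab_val, Nat.cast_sub (by have := (f i).2; omega), Nat.cast_sub (by have := i.2; omega)]
  ring

/-- For `n ≥ 3`, under the Tajima distribution on `COM_n`, the expected
internal tree length is `(n² + n − 6)/6`. -/
theorem stmt13 (n : ℕ) (hn : 3 ≤ n) :
    ∑ T : UCOM n, tajima n T * (itl n T : ℝ) = ((n : ℝ) ^ 2 + n - 6) / 6 := by
  obtain ⟨m, rfl⟩ : ∃ m, n = m + 2 := ⟨n - 2, by omega⟩
  choose e he1 he2 he3 using (exists_fun (m := m))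
  have hfac : ((m + 1).factorial : ℝ) ≠ 0 := by positivity
  have key : ∑ T : UCOM (m + 2), tajima (m + 2) T * (itl (m + 2) T : ℝ) =
      ∑ f : Fin m → Fin (m + 1), (wgt f / ((m + 1).factorial : ℝ)) *
        ∑ i : Fin m, (1 + ((i : ℕ) : ℝ) - ((f i : ℕ) : ℝ)) := by
    refine Finset.sum_of_injOn e ?_ (fun _ _ => by simp) ?_ ?_
    · intro T _ T' _ h
      apply Subtype.ext
      funext k
      apply Subtype.ext
      change uraw (m + 2) T k = uraw (m + 2) T' k
      rw [he3 T k, he3 T' k, h]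
    · intro f _ hf
      have : wgt f = 0 := by
        by_contra hw
        apply hf
        have ha : ∀ i, (f i : ℕ) ≤ i := by
          by_contra ha
          exact hw (if_neg ha)
        have hb : ∀ k, fibC f k ≤ 2 := by
          intro k
          by_contra hk
          apply hw
          unfold wgt
          rw [if_pos ha]
          refine Finset.prod_eq_zero (Finset.mem_univ k) ?_
          rw [Nat.descFactorial_of_lt (by omega)]
          simp
        have hv := pairOf_valid f ha hb
        let T : UCOM (m + 2) := ⟨fun k => ⟨pairOf f k, hv.1 k⟩, hv⟩
        refine ⟨T, by simp, ?_⟩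
        funext i
        have h := he3 T (f i).rev
        change pairOf f (f i).rev = _ at h
        have h' := congrArg (Multiset.count (lab i)) h
        rw [count_lab_pairOf, count_lab_pairOf] at h'
        by_contra hne
        simp [hne] at h'
      rw [this]; simp
    · intro T _
      rw [weight_eq T (e T) (he1 T) (he2 T) (he3 T), itl_eq T (e T) (he3 T)]
  rw [key]
  have := final_sum m
  simp_rw [div_mul_eq_mul_div]
  rw [← Finset.sum_div, this, mul_div_cancel_left₀ _ hfac]
  push_cast
  ring
end
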